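/- arXiv:2209.07901 — 3 statements merged into one kernel-verified Lean document; each statement's English description precedes it below -/
import Mathlib

section
/- Let σ,σ′ be gauge fields on the finite connected graph 𝒢. If there exists a bijection ψ̂ of V×{0,1} which is a graph isomorphism from the double cover 𝒢^db_σ onto the double cover 𝒢^db_{σ′} and satisfies π_{σ′}∘ψ̂=π_σ, then σ and σ′ are gauge-equivalent, i.e. σ′=σ̂·σ for some σ̂∈{−1,1}^V. -/
open scoped Classical

/-- The holonomy of a gauge field `σ` along a walk. -/
noncomputable def hol {V : Type*} {G : SimpleGraph V} (σ : V → V → ℝ)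
    {x y : V} (w : G.Walk x y) : ℝ :=
  (w.darts.map fun d => σ d.toProd.1 d.toProd.2).prod

/-- The double cover `𝒢^db_σ` of `G` induced by the gauge field `σ`: its vertex set is
`V × {0,1}` (here `V × Bool`), an edge `{x,y}` of `G` with `σ(x,y) = 1` lifts to the two
edges `{(x,i),(y,i)}`, and an edge with `σ(x,y) ≠ 1` (i.e. `σ(x,y) = −1` for a
`{-1,1}`-valued gauge field) lifts to the two crossing edges `{(x,i),(y,!i)}`. -/
def doubleCover {V : Type*} (G : SimpleGraph V) (σ : V → V → ℝ)
    (hσsym : ∀ x y, σ x y = σ y x) : SimpleGraph (V × Bool) where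
  Adj p q := G.Adj p.1 q.1 ∧ (p.2 = q.2 ↔ σ p.1 q.1 = 1)
  symm := by
    refine ⟨?_⟩
    rintro ⟨x, i⟩ ⟨y, j⟩ ⟨h1, h2⟩
    refine ⟨h1.symm, ?_⟩
    rw [hσsym y x]
    exact ⟨fun h => h2.mp h.symm, fun h => (h2.mpr h).symm⟩
  loopless := by
    refine ⟨?_⟩
    rintro ⟨x, i⟩ ⟨h1, _⟩
    exact G.loopless.irrefl x h1

/-- The covering involution `ψ` of the double cover, interchanging the two sheets. -/
def coverInvol {V : Type*} : V × Bool → V × Bool := fun p => (p.1, !p.2)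

/-- If there is a covering isomorphism between the double covers `𝒢^db_σ` and
`𝒢^db_{σ'}` (a bijection of `V × Bool` mapping edges onto edges and commuting with the
projections onto `V`), then `σ` and `σ'` are gauge-equivalent. -/
theorem covering_isomorphism_imp_gauge_equivalent {V : Type*} [Fintype V]
    (G : SimpleGraph V) (hconn : G.Connected)
    (C : V → V → ℝ) (hCsym : ∀ x y, C x y = C y x)
    (hCpos : ∀ x y, G.Adj x y → 0 < C x y)
    (σ σ' : V → V → ℝ)
    (hσsym : ∀ x y, σ x y = σ y x) (hσ'sym : ∀ x y, σ' x y = σ' y x)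
    (hσpm : ∀ x y, G.Adj x y → σ x y = 1 ∨ σ x y = -1)
    (hσ'pm : ∀ x y, G.Adj x y → σ' x y = 1 ∨ σ' x y = -1)
    (ψ : V × Bool → V × Bool) (hbij : Function.Bijective ψ)
    (hcov : ∀ p : V × Bool, (ψ p).1 = p.1)
    (hiso : ∀ p q : V × Bool,
      (doubleCover G σ hσsym).Adj p q ↔ (doubleCover G σ' hσ'sym).Adj (ψ p) (ψ q)) :
    ∃ σhat : V → ℝ, (∀ x, σhat x = 1 ∨ σhat x = -1) ∧
      ∀ x y, G.Adj x y → σ' x y = σhat x * σ x y * σhat y := by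
  refine ⟨fun x => if (ψ (x, false)).2 = false then 1 else -1, ?_, ?_⟩
  · intro x
    by_cases h : (ψ (x, false)).2 = false <;> simp [h]
  · intro x y hxy
    have h := hiso (x, false) (y, false)
    simp only [doubleCover, hcov, hxy, true_and, true_iff] at h
    have hne : ¬ ((-1 : ℝ) = 1) := by norm_num
    rcases hσpm x y hxy with h1 | h1 <;> rcases hσ'pm x y hxy with h2 | h2 <;>
      cases ha : (ψ (x, false)).2 <;> cases hb : (ψ (y, false)).2 <;>
      simp [h1, h2, ha, hb, hne] at h ⊢
end

section
/- Let σ be a gauge field on 𝒢 and let −Δ^db_σ denote the endomorphism of S_0^db given by f ↦ (the function equal to −(Δ^db_σ f)(x̂) at x̂∈V^db_int and 0 on V^db_∂). Then the determinant of the restriction of −Δ^db_σ to the invariant subspace S_{0,+}^db equals det((G(x,y))_{x,y∈V_int})^{−1}, and the determinant of its restriction to S_{0,−}^db equals det((G_σ(x,y))_{x,y∈V_int})^{−1}. Consequently det_{S_0^db}(−Δ^db_σ) = det((G)_{V_int})^{−1} · det((G_σ)_{V_int})^{−1}. -/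
open scoped Classical

/-- The space `S_0^db` of functions on the double cover vanishing on the boundary
`V^db_∂ = V_∂ × {0,1}` (the boundary being the complement of the interior `Vi`). -/
def S0db {V : Type*} [Fintype V] (Vi : Finset V) : Submodule ℝ ((V × Bool) → ℝ) where
  carrier := {f | ∀ p : V × Bool, p.1 ∉ Vi → f p = 0}
  add_mem' := by
    intro f g hf hg p hp
    simp [Pi.add_apply, hf p hp, hg p hp]
  zero_mem' := by intro p _; rfl
  smul_mem' := by
    intro c f hf p hp
    simp [Pi.smul_apply, hf p hp]

/-- The subspace `S_{0,+}^db` of `S_0^db` of functions invariant under the covering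
involution `ψ`. -/
def Spdb {V : Type*} [Fintype V] (Vi : Finset V) : Submodule ℝ ((V × Bool) → ℝ) where
  carrier := {f | (∀ p : V × Bool, p.1 ∉ Vi → f p = 0) ∧
    ∀ p : V × Bool, f (coverInvol p) = f p}
  add_mem' := by
    rintro f g ⟨hf, hf'⟩ ⟨hg, hg'⟩
    exact ⟨fun p hp => by simp [Pi.add_apply, hf p hp, hg p hp],
      fun p => by simp [Pi.add_apply, hf' p, hg' p]⟩
  zero_mem' := ⟨fun p _ => rfl, fun p => rfl⟩
  smul_mem' := by
    rintro c f ⟨hf, hf'⟩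
    exact ⟨fun p hp => by simp [Pi.smul_apply, hf p hp],
      fun p => by simp [Pi.smul_apply, hf' p]⟩

/-- The subspace `S_{0,−}^db` of `S_0^db` of functions anti-invariant under the covering
involution `ψ`. -/
def Smdb {V : Type*} [Fintype V] (Vi : Finset V) : Submodule ℝ ((V × Bool) → ℝ) where
  carrier := {f | (∀ p : V × Bool, p.1 ∉ Vi → f p = 0) ∧
    ∀ p : V × Bool, f (coverInvol p) = -f p}
  add_mem' := by
    rintro f g ⟨hf, hf'⟩ ⟨hg, hg'⟩
    refine ⟨fun p hp => by simp [Pi.add_apply, hf p hp, hg p hp],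
      fun p => by simp [Pi.add_apply, hf' p, hg' p]; ring⟩
  zero_mem' := ⟨fun p _ => rfl, fun p => by simp⟩
  smul_mem' := by
    rintro c f ⟨hf, hf'⟩
    exact ⟨fun p hp => by simp [Pi.smul_apply, hf p hp],
      fun p => by simp [Pi.smul_apply, hf' p]⟩


/-- The interior matrix of `−Δ_{H,σ}` (diagonal `W(x)`, off-diagonal `−σ(x,y)C(x,y)`). -/
noncomputable def minusTwistedLapMatrix {α : Type*} [Fintype α] (H : SimpleGraph α)
    (C σ : α → α → ℝ) (int : Finset α) : Matrix int int ℝ :=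
  Matrix.of fun x y : int =>
    if (x : α) = (y : α) then ∑ z : α, (if H.Adj (x : α) z then C (x : α) z else 0)
    else if H.Adj (x : α) (y : α) then -(σ (x : α) (y : α) * C (x : α) (y : α)) else 0

/-- The `σ`-twisted Green's function with zero boundary conditions. -/
noncomputable def twistedGreen {α : Type*} [Fintype α] (H : SimpleGraph α)
    (C σ : α → α → ℝ) (int : Finset α) : Matrix int int ℝ :=
  (minusTwistedLapMatrix H C σ int)⁻¹

/-- The endomorphism `−Δ^db_σ` of the space of functions on the double cover:
`f ↦ (the function equal to −(Δ^db_σ f)(x̂) at interior `x̂` and `0` on the boundary)`. -/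
noncomputable def minusLapDbOp {V : Type*} [Fintype V] (G : SimpleGraph V)
    (σ : V → V → ℝ) (hσsym : ∀ x y, σ x y = σ y x) (C : V → V → ℝ)
    (Vi : Finset V) [DecidablePred fun x : V => x ∈ Vi] :
    ((V × Bool) → ℝ) →ₗ[ℝ] ((V × Bool) → ℝ) where
  toFun f := fun p => if p.1 ∈ Vi then
    -(∑ q : V × Bool,
      if (doubleCover G σ hσsym).Adj p q then C p.1 q.1 * (f q - f p) else 0)
    else 0
  map_add' f g := by
    funext p
    simp only [Pi.add_apply]
    by_cases hp : p.1 ∈ Vi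
    · have h : ∀ q : V × Bool,
          (if (doubleCover G σ hσsym).Adj p q then
            C p.1 q.1 * ((f q + g q) - (f p + g p)) else 0) =
          (if (doubleCover G σ hσsym).Adj p q then C p.1 q.1 * (f q - f p) else 0) +
          (if (doubleCover G σ hσsym).Adj p q then C p.1 q.1 * (g q - g p) else 0) := by
        intro q
        by_cases hA : (doubleCover G σ hσsym).Adj p q <;> simp [hA] <;> ring
      simp only [hp, if_true]
      rw [Finset.sum_congr rfl fun q _ => h q, Finset.sum_add_distrib]
      ring
    · simp [hp]
  map_smul' c f := by
    funext p
    simp only [Pi.smul_apply, smul_eq_mul, RingHom.id_apply]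
    by_cases hp : p.1 ∈ Vi
    · have h : ∀ q : V × Bool,
          (if (doubleCover G σ hσsym).Adj p q then
            C p.1 q.1 * (c * f q - c * f p) else 0) =
          c * (if (doubleCover G σ hσsym).Adj p q then C p.1 q.1 * (f q - f p) else 0) := by
        intro q
        by_cases hA : (doubleCover G σ hσsym).Adj p q <;> simp [hA] <;> ring
      simp only [hp, if_true]
      rw [Finset.sum_congr rfl fun q _ => h q, ← Finset.mul_sum]
      ring
    · simp [hp]

namespace DbDet

/-- Extension by zero from the interior. -/
noncomputable def ext0 {V : Type*} (Vi : Finset V) (a : Vi → ℝ) (x : V) : ℝ :=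
  if h : x ∈ Vi then a ⟨x, h⟩ else 0

/-- The sign of a sheet. -/
def sgn (i : Bool) : ℝ := if i then -1 else 1

lemma ext0_mem {V : Type*} (Vi : Finset V) (a : Vi → ℝ) (x : Vi) : ext0 Vi a x = a x := by
  simp [ext0]

lemma ext0_not {V : Type*} (Vi : Finset V) (a : Vi → ℝ) (x : V) (h : x ∉ Vi) :
    ext0 Vi a x = 0 := by
  simp [ext0, h]

lemma mulVec_eq {V : Type*} [Fintype V] (G : SimpleGraph V) (C σ : V → V → ℝ) (Vi : Finset V)
    (a : Vi → ℝ) (x : Vi) :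
    (minusTwistedLapMatrix G C σ Vi).mulVec a x =
      ∑ y : V, if G.Adj x y then C x y * (ext0 Vi a x - σ x y * ext0 Vi a y) else 0 := by
  have h1 : ∀ y : Vi, minusTwistedLapMatrix G C σ Vi x y * a y =
      (if x = y then (∑ z : V, (if G.Adj (x : V) z then C (x : V) z else 0)) * a x else 0)
      - (if G.Adj (x : V) y then C x y * (σ x y * ext0 Vi a y) else 0) := by
    intro y
    rw [ext0_mem]
    by_cases hxy : x = y
    · subst hxy
      simp [minusTwistedLapMatrix]
    · have : (x : V) ≠ y := fun h => hxy (Subtype.ext h)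
      by_cases hA : G.Adj (x : V) y
      · simp [minusTwistedLapMatrix, hxy, hA, this]; ring
      · simp [minusTwistedLapMatrix, hxy, hA, this]
  have h2 : ∑ y : Vi, (if G.Adj (x : V) y then C x y * (σ x y * ext0 Vi a y) else 0) =
      ∑ y : V, (if G.Adj (x : V) y then C x y * (σ x y * ext0 Vi a y) else 0) := by
    rw [Finset.sum_coe_sort Vi
      (fun y => if G.Adj (x : V) y then C x y * (σ x y * ext0 Vi a y) else 0)]
    apply Finset.sum_subset (Finset.subset_univ _)
    intro y _ hy
    simp [ext0_not Vi a y hy]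
  rw [Matrix.mulVec, dotProduct, Finset.sum_congr rfl (fun y _ => h1 y), Finset.sum_sub_distrib,
    h2, Finset.sum_ite_eq, if_pos (Finset.mem_univ _), Finset.sum_mul, ← Finset.sum_sub_distrib]
  refine Finset.sum_congr rfl fun y _ => ?_
  rw [ext0_mem]
  split_ifs <;> ring

/-- The function on the cover with given symmetric and antisymmetric parts. -/
noncomputable def comb {V : Type*} (Vi : Finset V) (a b : Vi → ℝ) : V × Bool → ℝ :=
  fun p => ext0 Vi a p.1 + sgn p.2 * ext0 Vi b p.1

lemma op_comb {V : Type*} [Fintype V] (G : SimpleGraph V) (C σ : V → V → ℝ) (Vi : Finset V)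
    [DecidablePred fun x : V => x ∈ Vi]
    (hσsym : ∀ x y, σ x y = σ y x)
    (hσpm : ∀ x y, G.Adj x y → σ x y = 1 ∨ σ x y = -1) (a b : Vi → ℝ) :
    minusLapDbOp G σ hσsym C Vi (comb Vi a b) =
      comb Vi ((minusTwistedLapMatrix G C (fun _ _ => 1) Vi).mulVec a)
        ((minusTwistedLapMatrix G C σ Vi).mulVec b) := by
  funext p
  obtain ⟨x, i⟩ := p
  by_cases hx : x ∈ Vi
  · have e1 := ext0_mem Vi ((minusTwistedLapMatrix G C (fun _ _ => 1) Vi).mulVec a) ⟨x, hx⟩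
    have e2 := ext0_mem Vi ((minusTwistedLapMatrix G C σ Vi).mulVec b) ⟨x, hx⟩
    rw [mulVec_eq] at e1 e2
    simp only at e1 e2
    simp only [minusLapDbOp, LinearMap.coe_mk, AddHom.coe_mk, if_pos hx]
    simp only [comb]
    rw [e1, e2, Fintype.sum_prod_type, Finset.mul_sum, ← Finset.sum_add_distrib,
      ← Finset.sum_neg_distrib]
    refine Finset.sum_congr rfl fun y _ => ?_
    rw [Fintype.sum_bool]
    by_cases hA : G.Adj x y
    · have hn : (-1 : ℝ) ≠ 1 := by norm_num
      rcases hσpm x y hA with h | h <;> cases i <;>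
        simp [doubleCover, hA, h, comb, sgn, hn] <;> ring
    · simp [doubleCover, hA]
  · simp [minusLapDbOp, comb, ext0_not, hx]

lemma ext0_add {V : Type*} (Vi : Finset V) (a b : Vi → ℝ) (x : V) :
    ext0 Vi (a + b) x = ext0 Vi a x + ext0 Vi b x := by
  unfold ext0; split_ifs <;> simp

lemma ext0_smul {V : Type*} (Vi : Finset V) (c : ℝ) (a : Vi → ℝ) (x : V) :
    ext0 Vi (c • a) x = c * ext0 Vi a x := by
  unfold ext0; split_ifs <;> simp

lemma ext0_zero {V : Type*} (Vi : Finset V) (x : V) :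
    ext0 Vi 0 x = 0 := by
  unfold ext0; split_ifs <;> simp

/-- The splitting of `S_0^db`. -/
noncomputable def eZero {V : Type*} [Fintype V] (Vi : Finset V) :
    ((Vi → ℝ) × (Vi → ℝ)) ≃ₗ[ℝ] S0db (V := V) Vi where
  toFun ab := ⟨comb Vi ab.1 ab.2, fun p hp => by simp [comb, ext0_not, hp]⟩
  map_add' u v := by
    ext p; simp [comb, ext0_add]; ring
  map_smul' c u := by
    ext p; simp [comb, ext0_smul]; ring
  invFun f := (fun x => (f.1 (x, false) + f.1 (x, true)) / 2,
    fun x => (f.1 (x, false) - f.1 (x, true)) / 2)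
  left_inv u := by
    ext x <;> simp [comb, ext0_mem, sgn] <;> ring
  right_inv f := by
    ext ⟨x, i⟩
    by_cases hx : x ∈ Vi
    · cases i <;> simp [comb, ext0, hx, sgn] <;> ring
    · have := f.2 (x, i) hx
      simp [comb, ext0, hx, this]

/-- Interior functions and `S_{0,+}^db`. -/
noncomputable def ePlus {V : Type*} [Fintype V] (Vi : Finset V) :
    (Vi → ℝ) ≃ₗ[ℝ] Spdb (V := V) Vi where
  toFun a := ⟨comb Vi a 0, fun p hp => by simp [comb, ext0_not, hp],
    fun p => by simp [comb, coverInvol, ext0_zero]⟩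
  map_add' u v := by
    ext p; simp [comb, ext0_add, ext0_zero]
  map_smul' c u := by
    ext p; simp [comb, ext0_smul, ext0_zero]
  invFun f := fun x => f.1 (x, false)
  left_inv u := by
    ext x; simp [comb, ext0_mem, ext0_zero]
  right_inv f := by
    ext ⟨x, i⟩
    by_cases hx : x ∈ Vi
    · have := f.2.2 (x, false)
      simp only [coverInvol] at this
      cases i
      · simp [comb, ext0, hx]
      · simpa [comb, ext0, hx] using this.symm
    · have := f.2.1 (x, i) hx
      simp [comb, ext0, hx, this]

/-- Interior functions and `S_{0,−}^db`. -/
noncomputable def eMinus {V : Type*} [Fintype V] (Vi : Finset V) :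
    (Vi → ℝ) ≃ₗ[ℝ] Smdb (V := V) Vi where
  toFun a := ⟨comb Vi 0 a, fun p hp => by simp [comb, ext0_not, hp],
    fun p => by rcases p with ⟨x, _ | _⟩ <;> simp [comb, coverInvol, ext0_zero, sgn]⟩
  map_add' u v := by
    ext p; simp [comb, ext0_add, ext0_zero]; ring
  map_smul' c u := by
    ext p; simp [comb, ext0_smul, ext0_zero]; ring
  invFun f := fun x => f.1 (x, false)
  left_inv u := by
    ext x; simp [comb, ext0_mem, ext0_zero, sgn]
  right_inv f := by
    ext ⟨x, i⟩
    by_cases hx : x ∈ Vi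
    · have := f.2.2 (x, false)
      simp only [coverInvol] at this
      cases i
      · simp [comb, ext0, hx, sgn]
      · simpa [comb, ext0, hx, sgn] using this.symm
    · have := f.2.1 (x, i) hx
      simp [comb, ext0, hx, this]

lemma det_of_intertwine {M N : Type*} [AddCommGroup M] [Module ℝ M] [AddCommGroup N] [Module ℝ N]
    (e : M ≃ₗ[ℝ] N) (f : M →ₗ[ℝ] M) (g : N →ₗ[ℝ] N) (h : ∀ m, g (e m) = e (f m)) :
    LinearMap.det g = LinearMap.det f := by
  rw [← LinearMap.det_conj f e]
  congr 1
  ext n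
  simp [← h]

lemma det_green {V : Type*} [Fintype V] [DecidableEq V] (G : SimpleGraph V) (C σ : V → V → ℝ)
    (Vi : Finset V) :
    (twistedGreen G C σ Vi).det⁻¹ =
      LinearMap.det (Matrix.toLin' (minusTwistedLapMatrix G C σ Vi)) := by
  rw [LinearMap.det_toLin']
  have : ((minusTwistedLapMatrix G C σ Vi)⁻¹).det⁻¹ = (minusTwistedLapMatrix G C σ Vi).det := by
    rw [Matrix.det_nonsing_inv, Ring.inverse_eq_inv', inv_inv]
  rw [← this, twistedGreen]
  congr!

end DbDet

/-- The determinants of the restrictions of `−Δ^db_σ` to the invariant subspaces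
`S_{0,+}^db` and `S_{0,−}^db` are `det(G_{V_int})⁻¹` and `det((G_σ)_{V_int})⁻¹`
respectively; consequently the determinant of `−Δ^db_σ` on `S_0^db` is their
product. -/
theorem det_minusLapDbOp_restrict {V : Type*} [Fintype V] [DecidableEq V]
    (G : SimpleGraph V) (hconn : G.Connected)
    (Vi : Finset V) (hVi : Vi.Nonempty) (hVb : (Viᶜ : Finset V).Nonempty)
    (C : V → V → ℝ) (hCsym : ∀ x y, C x y = C y x)
    (hCpos : ∀ x y, G.Adj x y → 0 < C x y)
    (σ : V → V → ℝ) (hσsym : ∀ x y, σ x y = σ y x)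
    (hσpm : ∀ x y, G.Adj x y → σ x y = 1 ∨ σ x y = -1)
    (hplus : ∀ f ∈ Spdb (V := V) Vi,
      minusLapDbOp G σ hσsym C Vi f ∈ Spdb (V := V) Vi)
    (hminus : ∀ f ∈ Smdb (V := V) Vi,
      minusLapDbOp G σ hσsym C Vi f ∈ Smdb (V := V) Vi)
    (hzero : ∀ f ∈ S0db (V := V) Vi,
      minusLapDbOp G σ hσsym C Vi f ∈ S0db (V := V) Vi) :
    LinearMap.det ((minusLapDbOp G σ hσsym C Vi).restrict hplus) =
      (twistedGreen G C (fun _ _ => 1) Vi).det⁻¹ ∧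
    LinearMap.det ((minusLapDbOp G σ hσsym C Vi).restrict hminus) =
      (twistedGreen G C σ Vi).det⁻¹ ∧
    LinearMap.det ((minusLapDbOp G σ hσsym C Vi).restrict hzero) =
      (twistedGreen G C (fun _ _ => 1) Vi).det⁻¹ * (twistedGreen G C σ Vi).det⁻¹ := by
  simp only [DbDet.det_green]
  refine ⟨?_, ?_, ?_⟩
  · refine DbDet.det_of_intertwine (DbDet.ePlus Vi) _ _ fun a => Subtype.ext ?_
    have := DbDet.op_comb G C σ Vi hσsym hσpm a 0
    rw [Matrix.mulVec_zero] at this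
    exact this
  · refine DbDet.det_of_intertwine (DbDet.eMinus Vi) _ _ fun a => Subtype.ext ?_
    have := DbDet.op_comb G C σ Vi hσsym hσpm 0 a
    rw [Matrix.mulVec_zero] at this
    exact this
  · rw [← LinearMap.det_prodMap]
    refine DbDet.det_of_intertwine (DbDet.eZero Vi) _ _ fun a => Subtype.ext ?_
    exact DbDet.op_comb G C σ Vi hσsym hσpm a.1 a.2
end

section
/- Let σ be a gauge field on 𝒢 and let (φ^db(x̂))_{x̂∈V^db} be a centered Gaussian random vector on a probability space with covariance E[φ^db(x̂)φ^db(ŷ)] = G^db_σ(x̂,ŷ) for x̂,ŷ∈V^db_int and φ^db≡0 on V^db_∂ (the discrete GFF on the double cover). Define φ(x) = (φ^db(x,0)+φ^db(x,1))/√2 and φ_σ(x) = (φ^db(x,0)−φ^db(x,1))/√2 for x∈V. Then: (i) φ=(φ(x))_{x∈V} is a centered Gaussian vector with covariance E[φ(x)φ(y)]=G(x,y) (the discrete GFF on 𝒢 with zero boundary conditions); (ii) φ_σ=(φ_σ(x))_{x∈V} is a centered Gaussian vector with covariance E[φ_σ(x)φ_σ(y)]=G_σ(x,y) (the σ-twisted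 discrete GFF with zero boundary conditions); (iii) the random vectors φ and φ_σ are independent. -/
open scoped Classical

/-- The (untwisted) Green's function of the double cover `𝒢^db_σ`, with zero boundary
conditions on `V^db_∂ = V_∂ × {0,1}`: the inverse of the interior matrix of minus its
graph Laplacian, the conductances being `C((x,i),(y,j)) = C(x,y)`. -/
noncomputable def greenDb {V : Type*} [Fintype V] (G : SimpleGraph V)
    (σ : V → V → ℝ) (hσsym : ∀ x y, σ x y = σ y x) (C : V → V → ℝ)
    (Vi : Finset V) :
    Matrix ↥(Vi ×ˢ (Finset.univ : Finset Bool)) ↥(Vi ×ˢ (Finset.univ : Finset Bool)) ℝ :=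
  twistedGreen (doubleCover G σ hσsym) (fun a b => C a.1 b.1) (fun _ _ => 1)
    (Vi ×ˢ (Finset.univ : Finset Bool))

/-- The Green's function of the double cover, extended by `0` when one of the arguments
is on the boundary. -/
noncomputable def greenDbKer {V : Type*} [Fintype V] (G : SimpleGraph V)
    (σ : V → V → ℝ) (hσsym : ∀ x y, σ x y = σ y x) (C : V → V → ℝ)
    (Vi : Finset V) (p q : V × Bool) : ℝ :=
  if hp : p ∈ Vi ×ˢ (Finset.univ : Finset Bool) then
    if hq : q ∈ Vi ×ˢ (Finset.univ : Finset Bool) then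
      greenDb G σ hσsym C Vi ⟨p, hp⟩ ⟨q, hq⟩
    else 0
  else 0

/-- The `σ`-twisted Green's function of `𝒢`, extended by `0` when one of the arguments
is on the boundary. -/
noncomputable def greenKer {V : Type*} [Fintype V] (G : SimpleGraph V)
    (C σ : V → V → ℝ) (Vi : Finset V) (x y : V) : ℝ :=
  if hx : x ∈ Vi then
    if hy : y ∈ Vi then twistedGreen G C σ Vi ⟨x, hx⟩ ⟨y, hy⟩ else 0
  else 0

section Helpers

variable {V : Type*} [Fintype V]

lemma lap_mulVec (G : SimpleGraph V) (C σ : V → V → ℝ) (Vi : Finset V)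
    (f : V → ℝ) (hf : ∀ x, x ∉ Vi → f x = 0) (x : Vi) :
    (minusTwistedLapMatrix G C σ Vi).mulVec (fun y => f y) x
      = ∑ y, (if G.Adj x y then C x y * (f x - σ x y * f y) else 0) := by
  have h1 : (minusTwistedLapMatrix G C σ Vi).mulVec (fun y => f y) x
      = ∑ y : V, (if (x : V) = y then ∑ z : V, (if G.Adj (x : V) z then C (x : V) z else 0)
    else if G.Adj (x : V) y then -(σ (x : V) y * C (x : V) y) else 0) * f y := by
    rw [← Finset.sum_subset (Finset.subset_univ Vi)]
    · rw [← Finset.sum_coe_sort Vi]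
      rfl
    · intro y _ hy
      rw [hf y hy, mul_zero]
  rw [h1]
  have h2 : ∀ y : V, (if (x : V) = y then ∑ z : V, (if G.Adj (x : V) z then C (x : V) z else 0)
    else if G.Adj (x : V) y then -(σ (x : V) y * C (x : V) y) else 0) * f y
    = (if (x : V) = y then (∑ z : V, (if G.Adj (x : V) z then C (x : V) z else 0)) * f x else 0)
     + (if G.Adj (x : V) y then -(σ (x : V) y * C (x : V) y) * f y else 0) := by
    intro y
    by_cases hxy : (x : V) = y
    · have : ¬ G.Adj (x : V) y := by rw [hxy]; exact G.loopless.irrefl y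
      simp [this, hxy]
    · simp [hxy]
  rw [Finset.sum_congr rfl (fun y _ => h2 y), Finset.sum_add_distrib, Finset.sum_ite_eq]
  simp only [Finset.mem_univ, if_true]
  rw [Finset.sum_mul, ← Finset.sum_add_distrib]
  refine Finset.sum_congr rfl fun y _ => ?_
  split_ifs <;> ring

lemma lap_energy (G : SimpleGraph V) (C σ : V → V → ℝ) (Vi : Finset V)
    (hCsym : ∀ x y, C x y = C y x) (hσsym : ∀ x y, σ x y = σ y x)
    (hσpm : ∀ x y, G.Adj x y → σ x y = 1 ∨ σ x y = -1)
    (f : V → ℝ) (hf : ∀ x, x ∉ Vi → f x = 0) :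
    2 * ∑ x : Vi, f x * (minusTwistedLapMatrix G C σ Vi).mulVec (fun y => f y) x
      = ∑ x, ∑ y, (if G.Adj x y then C x y * (f x - σ x y * f y) ^ 2 else 0) := by
  have h1 : ∑ x : Vi, f x * (minusTwistedLapMatrix G C σ Vi).mulVec (fun y => f y) x
      = ∑ x, ∑ y, (if G.Adj x y then C x y * (f x - σ x y * f y) * f x else 0) := by
    rw [← Finset.sum_subset (Finset.subset_univ Vi), ← Finset.sum_coe_sort Vi]
    · refine Finset.sum_congr rfl fun x _ => ?_
      rw [lap_mulVec G C σ Vi f hf x, Finset.mul_sum]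
      refine Finset.sum_congr rfl fun y _ => ?_
      split_ifs <;> ring
    · intro x _ hx
      simp [hf x hx]
  rw [two_mul, h1]
  conv_lhs =>
    arg 2
    rw [Finset.sum_comm]
  rw [← Finset.sum_add_distrib]
  refine Finset.sum_congr rfl fun x _ => ?_
  rw [← Finset.sum_add_distrib]
  refine Finset.sum_congr rfl fun y _ => ?_
  by_cases h : G.Adj x y
  · simp only [h, h.symm, if_true]
    rw [hCsym y x, hσsym y x]
    rcases hσpm x y h with h | h <;> rw [h] <;> ring
  · have h' : ¬ G.Adj y x := fun k => h k.symm
    simp [h, h']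

lemma energy_nonneg (G : SimpleGraph V) (C σ : V → V → ℝ)
    (hCpos : ∀ x y, G.Adj x y → 0 < C x y) (f : V → ℝ) (x y : V) :
    0 ≤ (if G.Adj x y then C x y * (f x - σ x y * f y) ^ 2 else 0) := by
  split_ifs with h
  · have := hCpos x y h
    positivity
  · exact le_rfl

lemma lap_isUnit (G : SimpleGraph V) (hconn : G.Connected) (C σ : V → V → ℝ) (Vi : Finset V)
    (hVb : ∃ b, b ∉ Vi)
    (hCpos : ∀ x y, G.Adj x y → 0 < C x y)
    (hCsym : ∀ x y, C x y = C y x) (hσsym : ∀ x y, σ x y = σ y x)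
    (hσpm : ∀ x y, G.Adj x y → σ x y = 1 ∨ σ x y = -1) :
    IsUnit (minusTwistedLapMatrix G C σ Vi) := by
  rw [← Matrix.mulVec_injective_iff_isUnit]
  change Function.Injective (minusTwistedLapMatrix G C σ Vi).mulVecLin
  rw [injective_iff_map_eq_zero (minusTwistedLapMatrix G C σ Vi).mulVecLin]
  intro g hg
  rw [Matrix.mulVecLin_apply] at hg
  set f : V → ℝ := fun x => if h : x ∈ Vi then g ⟨x, h⟩ else 0 with hfdef
  have hf : ∀ x, x ∉ Vi → f x = 0 := fun x hx => by simp [hfdef, hx]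
  have hfg : (fun y : Vi => f y) = g := by
    funext y; simp [hfdef]
  have hE := lap_energy G C σ Vi hCsym hσsym hσpm f hf
  rw [hfg, hg] at hE
  simp only [Pi.zero_apply, mul_zero, Finset.sum_const_zero] at hE
  have hnn := energy_nonneg G C σ hCpos f
  have h0 : ∀ x y, G.Adj x y → |f x| = |f y| := by
    intro x y h
    have h1 := (Finset.sum_eq_zero_iff_of_nonneg
      (fun x _ => Finset.sum_nonneg fun y _ => hnn x y)).1 hE.symm x (Finset.mem_univ _)
    have h2 := (Finset.sum_eq_zero_iff_of_nonneg (fun y _ => hnn x y)).1 h1 y (Finset.mem_univ _)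
    rw [if_pos h] at h2
    have h3 : f x - σ x y * f y = 0 := by
      rcases mul_eq_zero.1 h2 with h4 | h4
      · exact absurd h4 (hCpos x y h).ne'
      · exact pow_eq_zero_iff (two_ne_zero) |>.1 h4
    have h5 : f x = σ x y * f y := by linarith
    rw [h5, abs_mul]
    rcases hσpm x y h with h | h <;> simp [h]
  obtain ⟨b, hb⟩ := hVb
  have hw : ∀ x y, G.Walk x y → |f x| = |f y| := by
    intro x y w
    induction w with
    | nil => rfl
    | cons h _ ih => exact (h0 _ _ h).trans ih
  rw [← hfg]
  funext y
  obtain ⟨w⟩ := hconn.preconnected (y : V) b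
  have := hw _ _ w
  rw [hf b hb, abs_zero, abs_eq_zero] at this
  exact this

lemma green_nonneg (G : SimpleGraph V) (hconn : G.Connected) (C σ : V → V → ℝ) (Vi : Finset V)
    (hVb : ∃ b, b ∉ Vi)
    (hCpos : ∀ x y, G.Adj x y → 0 < C x y)
    (hCsym : ∀ x y, C x y = C y x) (hσsym : ∀ x y, σ x y = σ y x)
    (hσpm : ∀ x y, G.Adj x y → σ x y = 1 ∨ σ x y = -1) (a : V → ℝ) :
    0 ≤ ∑ x : V, ∑ y : V, a x * greenKer G C σ Vi x y * a y := by
  have hu := lap_isUnit G hconn C σ Vi hVb hCpos hCsym hσsym hσpm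
  set f : V → ℝ := fun x => ∑ y, greenKer G C σ Vi x y * a y with hfdef
  have hf : ∀ x, x ∉ Vi → f x = 0 := fun x hx => by simp [hfdef, greenKer, hx]
  have hfg : (fun x : Vi => f x) = (twistedGreen G C σ Vi).mulVec (fun y => a y) := by
    funext x
    simp only [hfdef, Matrix.mulVec, dotProduct]
    rw [← Finset.sum_subset (Finset.subset_univ Vi), ← Finset.sum_coe_sort Vi]
    · refine Finset.sum_congr rfl fun y _ => ?_
      simp [greenKer]
    · intro y _ hy
      simp [greenKer, hy]
  have hE := lap_energy G C σ Vi hCsym hσsym hσpm f hf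
  rw [hfg, Matrix.mulVec_mulVec, twistedGreen,
    Matrix.mul_nonsing_inv _ ((Matrix.isUnit_iff_isUnit_det _).1 hu), Matrix.one_mulVec] at hE
  have h1 : ∑ x : V, ∑ y : V, a x * greenKer G C σ Vi x y * a y = ∑ x : Vi, f x * a x := by
    rw [Finset.sum_coe_sort Vi (fun x => f x * a x),
      Finset.sum_subset (Finset.subset_univ Vi) (fun x _ hx => by rw [hf x hx, zero_mul])]
    refine Finset.sum_congr rfl fun x _ => ?_
    rw [hfdef, Finset.sum_mul]
    refine Finset.sum_congr rfl fun y _ => ?_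
    ring
  rw [h1]
  have := Finset.sum_nonneg fun x (_ : x ∈ Finset.univ) =>
    Finset.sum_nonneg fun y (_ : y ∈ Finset.univ) => energy_nonneg G C σ hCpos f x y
  linarith

/-- The sign attached to a pair of sheets. -/
noncomputable def sheetSign (i j : Bool) : ℝ := if i = j then 1 else -1

/-- The projection of an interior vertex of the double cover. -/
def projInt {Vi : Finset V} (p : ↥(Vi ×ˢ (Finset.univ : Finset Bool))) : Vi :=
  ⟨p.1.1, (Finset.mem_product.1 p.2).1⟩

lemma lap_db (G : SimpleGraph V) (σ : V → V → ℝ) (hσsym : ∀ x y, σ x y = σ y x)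
    (hσpm : ∀ x y, G.Adj x y → σ x y = 1 ∨ σ x y = -1) (C : V → V → ℝ) (Vi : Finset V)
    (p q : ↥(Vi ×ˢ (Finset.univ : Finset Bool))) :
    minusTwistedLapMatrix (doubleCover G σ hσsym) (fun a b => C a.1 b.1) (fun _ _ => 1)
      (Vi ×ˢ (Finset.univ : Finset Bool)) p q
    = (minusTwistedLapMatrix G C (fun _ _ => 1) Vi (projInt p) (projInt q)
      + sheetSign p.1.2 q.1.2 * minusTwistedLapMatrix G C σ Vi (projInt p) (projInt q)) / 2 := by
  obtain ⟨⟨x, i⟩, hp⟩ := p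
  obtain ⟨⟨y, j⟩, hq⟩ := q
  simp only [minusTwistedLapMatrix, Matrix.of_apply, projInt, sheetSign, Prod.mk.injEq]
  have hW : ∑ z : V × Bool, (if (doubleCover G σ hσsym).Adj (x, i) z then C x z.1 else 0)
      = ∑ z : V, (if G.Adj x z then C x z else 0) := by
    rw [Fintype.sum_prod_type]
    refine Finset.sum_congr rfl fun z _ => ?_
    simp only [doubleCover, Fintype.sum_bool]
    by_cases h : G.Adj x z
    · by_cases hs : σ x z = 1 <;> cases i <;> simp [h, hs]
    · simp [h]
  rw [hW]
  by_cases hxy : x = y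
  · subst hxy
    by_cases hij : i = j
    · simp [hij]
    · simp [hij, doubleCover]
  · by_cases h : G.Adj x y
    · have hs' : ((-1 : ℝ) = 1) ↔ False := by norm_num
      rcases hσpm x y h with hs | hs <;> by_cases hij : i = j <;>
        simp [hxy, h, hs, hij, doubleCover, hs'] <;> ring
    · simp [hxy, h, doubleCover]

lemma sum_int_db (Vi : Finset V) (F : Vi → Bool → ℝ) :
    ∑ p : ↥(Vi ×ˢ (Finset.univ : Finset Bool)), F (projInt p) p.1.2
      = ∑ x : Vi, (F x true + F x false) := by
  have : ∑ x : Vi, (F x true + F x false) = ∑ q : Vi × Bool, F q.1 q.2 := by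
    rw [Fintype.sum_prod_type]
    simp
  rw [this]
  refine Finset.sum_bij' (fun p _ => (projInt p, p.1.2))
    (fun q _ => ⟨(q.1.1, q.2), Finset.mem_product.2 ⟨q.1.2, Finset.mem_univ _⟩⟩) ?_
    (fun _ _ => Finset.mem_univ _) ?_ ?_ ?_
  all_goals simp [projInt]

lemma green_db (G : SimpleGraph V) (hconn : G.Connected)
    (σ : V → V → ℝ) (hσsym : ∀ x y, σ x y = σ y x)
    (hσpm : ∀ x y, G.Adj x y → σ x y = 1 ∨ σ x y = -1) (C : V → V → ℝ) (Vi : Finset V)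
    (hVb : ∃ b, b ∉ Vi)
    (hCpos : ∀ x y, G.Adj x y → 0 < C x y)
    (hCsym : ∀ x y, C x y = C y x)
    (p q : ↥(Vi ×ˢ (Finset.univ : Finset Bool))) :
    greenDb G σ hσsym C Vi p q
    = (twistedGreen G C (fun _ _ => 1) Vi (projInt p) (projInt q)
      + sheetSign p.1.2 q.1.2 * twistedGreen G C σ Vi (projInt p) (projInt q)) / 2 := by
  have hu1 := lap_isUnit G hconn C (fun _ _ => 1) Vi hVb hCpos hCsym (fun _ _ => rfl)
    (fun _ _ _ => Or.inl rfl)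
  have hu2 := lap_isUnit G hconn C σ Vi hVb hCpos hCsym hσsym hσpm
  have e1 := Matrix.mul_nonsing_inv _ ((Matrix.isUnit_iff_isUnit_det _).1 hu1)
  have e2 := Matrix.mul_nonsing_inv _ ((Matrix.isUnit_iff_isUnit_det _).1 hu2)
  have key : greenDb G σ hσsym C Vi = Matrix.of (fun p q =>
      (twistedGreen G C (fun _ _ => 1) Vi (projInt p) (projInt q)
      + sheetSign p.1.2 q.1.2 * twistedGreen G C σ Vi (projInt p) (projInt q)) / 2) := by
    unfold greenDb twistedGreen
    refine @Matrix.inv_eq_right_inv _ _ _ (_) _ _ _ ?_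
    ext p q
    rw [Matrix.mul_apply]
    simp only [Matrix.of_apply, lap_db G σ hσsym hσpm C Vi]
    generalize minusTwistedLapMatrix G C (fun _ _ => 1) Vi = A at *
    generalize minusTwistedLapMatrix G C σ Vi = B at *
    rw [sum_int_db Vi (fun z k => (A (projInt p) z + sheetSign p.1.2 k * B (projInt p) z) / 2 *
      ((A⁻¹ z (projInt q) + sheetSign k q.1.2 * B⁻¹ z (projInt q)) / 2))]
    have e1' := congrFun (congrFun e1 (projInt p)) (projInt q)
    have e2' := congrFun (congrFun e2 (projInt p)) (projInt q)
    rw [Matrix.mul_apply] at e1' e2'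
    have : ∀ z : Vi, (A (projInt p) z + sheetSign p.1.2 true * B (projInt p) z) / 2 *
      ((A⁻¹ z (projInt q) + sheetSign true q.1.2 * B⁻¹ z (projInt q)) / 2)
      + (A (projInt p) z + sheetSign p.1.2 false * B (projInt p) z) / 2 *
      ((A⁻¹ z (projInt q) + sheetSign false q.1.2 * B⁻¹ z (projInt q)) / 2)
      = (1/2) * (A (projInt p) z * A⁻¹ z (projInt q))
        + (sheetSign p.1.2 q.1.2 / 2) * (B (projInt p) z * B⁻¹ z (projInt q)) := by
      intro z
      generalize p.1.2 = i
      generalize q.1.2 = j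
      cases i <;> cases j <;> simp [sheetSign] <;> ring
    rw [Finset.sum_congr rfl (fun z _ => this z), Finset.sum_add_distrib, ← Finset.mul_sum,
      ← Finset.mul_sum, e1', e2']
    obtain ⟨⟨x, i⟩, hp⟩ := p
    obtain ⟨⟨y, j⟩, hq⟩ := q
    simp only [Matrix.one_apply, projInt, sheetSign, Subtype.mk.injEq, Prod.mk.injEq]
    by_cases hxy : x = y <;> by_cases hij : i = j <;> simp [hxy, hij]
    all_goals norm_num
  rw [key]
  rfl

lemma greenKer_db (G : SimpleGraph V) (hconn : G.Connected)
    (σ : V → V → ℝ) (hσsym : ∀ x y, σ x y = σ y x)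
    (hσpm : ∀ x y, G.Adj x y → σ x y = 1 ∨ σ x y = -1) (C : V → V → ℝ) (Vi : Finset V)
    (hVb : ∃ b, b ∉ Vi)
    (hCpos : ∀ x y, G.Adj x y → 0 < C x y)
    (hCsym : ∀ x y, C x y = C y x) (x y : V) (i j : Bool) :
    greenDbKer G σ hσsym C Vi (x, i) (y, j)
      = (greenKer G C (fun _ _ => 1) Vi x y + sheetSign i j * greenKer G C σ Vi x y) / 2 := by
  by_cases hx : x ∈ Vi
  · by_cases hy : y ∈ Vi
    · simp only [greenDbKer, greenKer, hx, hy, Finset.mem_product, Finset.mem_univ, and_self,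
        dite_true]
      exact green_db G hconn σ hσsym hσpm C Vi hVb hCpos hCsym _ _
    · simp [greenDbKer, greenKer, hx, hy]
  · simp [greenDbKer, greenKer, hx]

open MeasureTheory ProbabilityTheory in
lemma joint_law (G : SimpleGraph V) (hconn : G.Connected)
    (Vi : Finset V) (hVb : ∃ b, b ∉ Vi)
    (C : V → V → ℝ) (hCsym : ∀ x y, C x y = C y x)
    (hCpos : ∀ x y, G.Adj x y → 0 < C x y)
    (σ : V → V → ℝ) (hσsym : ∀ x y, σ x y = σ y x)
    (hσpm : ∀ x y, G.Adj x y → σ x y = 1 ∨ σ x y = -1)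
    {Ω : Type*} [MeasurableSpace Ω] (P : Measure Ω)
    (φdb : Ω → (V × Bool) → ℝ)
    (hgauss : ∀ a : (V × Bool) → ℝ,
      Measure.map (fun ω => ∑ p : V × Bool, a p * φdb ω p) P =
        gaussianReal 0
          (∑ p : V × Bool, ∑ q : V × Bool,
            a p * greenDbKer G σ hσsym C Vi p q * a q).toNNReal) (a b : V → ℝ) :
      Measure.map
          (fun ω => (∑ x : V, a x * ((φdb ω (x, false) + φdb ω (x, true)) / Real.sqrt 2))
            + ∑ x : V, b x * ((φdb ω (x, false) - φdb ω (x, true)) / Real.sqrt 2)) P =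
        gaussianReal 0
          ((∑ x : V, ∑ y : V, a x * greenKer G C (fun _ _ => 1) Vi x y * a y)
            + ∑ x : V, ∑ y : V, b x * greenKer G C σ Vi x y * b y).toNNReal := by
  have h := hgauss (fun p => (a p.1 + (if p.2 then -1 else 1) * b p.1) / Real.sqrt 2)
  convert h using 3
  · rw [Fintype.sum_prod_type, ← Finset.sum_add_distrib]
    refine Finset.sum_congr rfl fun x _ => ?_
    simp
    ring
  · have hs : Real.sqrt 2 ^ 2 = 2 := Real.sq_sqrt (by norm_num)
    have hs' : (Real.sqrt 2)⁻¹ ^ 2 = 1 / 2 := by rw [inv_pow, hs]; norm_num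
    simp only [Fintype.sum_prod_type, Fintype.sum_bool,
      greenKer_db G hconn σ hσsym hσpm C Vi hVb hCpos hCsym]
    rw [← Finset.sum_add_distrib]
    refine Finset.sum_congr rfl fun x _ => ?_
    rw [← Finset.sum_add_distrib, ← Finset.sum_add_distrib]
    refine Finset.sum_congr rfl fun y _ => ?_
    simp [sheetSign, div_eq_mul_inv]
    ring_nf
    rw [hs']
    ring

end Helpers

open MeasureTheory ProbabilityTheory in
/-- Let `φ^db` be the discrete GFF on the double cover `𝒢^db_σ` (the centered Gaussian
vector with covariance `G^db_σ`, vanishing on the boundary). Then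
`φ = (φ^db∘ι₀ + φ^db∘ι₁)/√2` is the discrete GFF on `𝒢` (centered Gaussian with
covariance `G`), `φ_σ = (φ^db∘ι₀ − φ^db∘ι₁)/√2` is the `σ`-twisted discrete GFF
(centered Gaussian with covariance `G_σ`), and `φ` and `φ_σ` are independent.
"Centered Gaussian with covariance `K`" means that every linear functional `⟨a,·⟩` has
the one-dimensional Gaussian law with mean `0` and variance `aᵀKa`. -/
theorem doubleCover_GFF_decomposition {V : Type*} [Fintype V] [DecidableEq V]
    (G : SimpleGraph V) (hconn : G.Connected)
    (Vi : Finset V) (hVi : Vi.Nonempty) (hVb : (Viᶜ : Finset V).Nonempty)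
    (C : V → V → ℝ) (hCsym : ∀ x y, C x y = C y x)
    (hCpos : ∀ x y, G.Adj x y → 0 < C x y)
    (σ : V → V → ℝ) (hσsym : ∀ x y, σ x y = σ y x)
    (hσpm : ∀ x y, G.Adj x y → σ x y = 1 ∨ σ x y = -1)
    {Ω : Type*} [MeasurableSpace Ω] (P : Measure Ω) [IsProbabilityMeasure P]
    (φdb : Ω → (V × Bool) → ℝ)
    (hmeas : ∀ p : V × Bool, Measurable fun ω => φdb ω p)
    (hboundary : ∀ (ω : Ω) (p : V × Bool), p.1 ∉ Vi → φdb ω p = 0)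
    (hgauss : ∀ a : (V × Bool) → ℝ,
      Measure.map (fun ω => ∑ p : V × Bool, a p * φdb ω p) P =
        gaussianReal 0
          (∑ p : V × Bool, ∑ q : V × Bool,
            a p * greenDbKer G σ hσsym C Vi p q * a q).toNNReal) :
    (∀ a : V → ℝ,
      Measure.map
          (fun ω => ∑ x : V,
            a x * ((φdb ω (x, false) + φdb ω (x, true)) / Real.sqrt 2)) P =
        gaussianReal 0
          (∑ x : V, ∑ y : V,
            a x * greenKer G C (fun _ _ => 1) Vi x y * a y).toNNReal) ∧
    (∀ a : V → ℝ,
      Measure.map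
          (fun ω => ∑ x : V,
            a x * ((φdb ω (x, false) - φdb ω (x, true)) / Real.sqrt 2)) P =
        gaussianReal 0
          (∑ x : V, ∑ y : V, a x * greenKer G C σ Vi x y * a y).toNNReal) ∧
    IndepFun
      (fun ω => fun x : V => (φdb ω (x, false) + φdb ω (x, true)) / Real.sqrt 2)
      (fun ω => fun x : V => (φdb ω (x, false) - φdb ω (x, true)) / Real.sqrt 2)
      P := by
  have hVb' : ∃ b, b ∉ Vi := by
    obtain ⟨b, hb⟩ := hVb
    exact ⟨b, Finset.mem_compl.1 hb⟩
  have hJ := joint_law G hconn Vi hVb' C hCsym hCpos σ hσsym hσpm P φdb hgauss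
  have h1 := fun a => hJ a 0
  have h2 := fun b => hJ 0 b
  simp only [Pi.zero_apply, zero_mul, mul_zero, Finset.sum_const_zero, add_zero, zero_add]
    at h1 h2
  refine ⟨h1, h2, ?_⟩
  have hX : Measurable (fun ω => fun x : V => (φdb ω (x, false) + φdb ω (x, true)) / Real.sqrt 2) :=
    measurable_pi_lambda _ fun x => ((hmeas _).add (hmeas _)).div_const _
  have hY : Measurable (fun ω => fun x : V => (φdb ω (x, false) - φdb ω (x, true)) / Real.sqrt 2) :=
    measurable_pi_lambda _ fun x => ((hmeas _).sub (hmeas _)).div_const _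
  rw [indepFun_iff_charFunDual_prod hX.aemeasurable hY.aemeasurable]
  intro L
  have hlin : ∀ (M : StrongDual ℝ (V → ℝ)) (v : V → ℝ),
      M v = ∑ x, M (Pi.single x 1) * v x := by
    intro M v
    conv_lhs => rw [pi_eq_sum_univ' v]
    rw [map_sum]
    refine Finset.sum_congr rfl fun x _ => ?_
    rw [map_smul, smul_eq_mul, mul_comm]
  obtain ⟨a, ha⟩ : ∃ a : V → ℝ, ∀ v, L.comp (.inl ℝ (V → ℝ) (V → ℝ)) v = ∑ x, a x * v x :=
    ⟨_, hlin _⟩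
  obtain ⟨b, hb⟩ : ∃ b : V → ℝ, ∀ v, L.comp (.inr ℝ (V → ℝ) (V → ℝ)) v = ∑ x, b x * v x :=
    ⟨_, hlin _⟩
  have hL : ∀ v w : V → ℝ, L (v, w) = ∑ x, a x * v x + ∑ x, b x * w x := by
    intro v w
    rw [← ha, ← hb]
    simp [← map_add]
  rw [charFunDual_eq_charFun_map_one, charFunDual_eq_charFun_map_one,
    charFunDual_eq_charFun_map_one,
    Measure.map_map (by fun_prop) (hX.prodMk hY), Measure.map_map (by fun_prop) hX,
    Measure.map_map (by fun_prop) hY]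
  have c0 := hJ a b
  have c1 := h1 a
  have c2 := h2 b
  simp only [Function.comp_def, hL, ha, hb]
  rw [c0, c1, c2, charFun_gaussianReal, charFun_gaussianReal, charFun_gaussianReal,
    ← Complex.exp_add]
  have n1 := green_nonneg G hconn C (fun _ _ => 1) Vi hVb' hCpos hCsym (fun _ _ => rfl)
    (fun _ _ _ => Or.inl rfl) a
  have n2 := green_nonneg G hconn C σ Vi hVb' hCpos hCsym hσsym hσpm b
  rw [Real.toNNReal_add n1 n2]
  congr 1
  push_cast
  ring
end
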